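/- Let L, c, g > 0, s_* ∈ (0,1), and let k : ℝ → ℝ be continuously differentiable. Let s be C¹ and p be C² on an open set containing [0,L] × ℝ, satisfying at every point the travelling-wave Richards equation c ∂_z s = ∂_y(k(s) ∂_y p) + ∂_z(k(s)(∂_z p + g)) and the homogeneous lateral Neumann conditions ∂_y p(0,z) = ∂_y p(L,z) = 0 for all z ∈ ℝ. Assume that as z → −∞, s(·,z) → s_* uniformly on [0,L] and k(s(·,z)) ∇p(·,z) → 0 uniformly on [0,L]. Then for every z ∈ ℝ: ∫₀^L [k(s(y,z))(∂_z p(y,z) + g) − c s(y,z)] dy = (g k(s_*) − c s_*) L. -/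

import Mathlib

open MeasureTheory Set Filter

/-- Partial derivative in the first (horizontal, `y`) variable. -/
noncomputable def pdy (f : ℝ × ℝ → ℝ) (x : ℝ × ℝ) : ℝ := deriv (fun t => f (t, x.2)) x.1

/-- Partial derivative in the second (vertical, `z`) variable. -/
noncomputable def pdz (f : ℝ × ℝ → ℝ) (x : ℝ × ℝ) : ℝ := deriv (fun t => f (x.1, t)) x.2

theorem pdy_eq_fderiv {f : ℝ × ℝ → ℝ} {x : ℝ × ℝ} (hf : DifferentiableAt ℝ f x) :
    pdy f x = fderiv ℝ f x (1, 0) :=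
  (HasFDerivAt.comp_hasDerivAt (f := fun t => (t, x.2)) x.1 hf.hasFDerivAt
    ((hasDerivAt_id x.1).prodMk (hasDerivAt_const x.1 x.2))).deriv

theorem pdz_eq_fderiv {f : ℝ × ℝ → ℝ} {x : ℝ × ℝ} (hf : DifferentiableAt ℝ f x) :
    pdz f x = fderiv ℝ f x (0, 1) :=
  (HasFDerivAt.comp_hasDerivAt (f := fun t => (x.1, t)) x.2 hf.hasFDerivAt
    ((hasDerivAt_const x.2 x.1).prodMk (hasDerivAt_id x.2))).deriv

theorem ContDiffOn.pdy {p : ℝ × ℝ → ℝ} {U : Set (ℝ × ℝ)} (hp : ContDiffOn ℝ 2 p U)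
    (hU : IsOpen U) : ContDiffOn ℝ 1 (pdy p) U :=
  ((hp.fderiv_of_isOpen hU (by norm_num)).clm_apply contDiffOn_const).congr fun _ hx =>
    pdy_eq_fderiv ((hp.differentiableOn (by norm_num)).differentiableAt (hU.mem_nhds hx))

theorem ContDiffOn.pdz {p : ℝ × ℝ → ℝ} {U : Set (ℝ × ℝ)} (hp : ContDiffOn ℝ 2 p U)
    (hU : IsOpen U) : ContDiffOn ℝ 1 (pdz p) U :=
  ((hp.fderiv_of_isOpen hU (by norm_num)).clm_apply contDiffOn_const).congr fun _ hx =>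
    pdz_eq_fderiv ((hp.differentiableOn (by norm_num)).differentiableAt (hU.mem_nhds hx))

/-- The vertical flux of a divergence-free `C¹` field on a strip which is tangent to the lateral
boundary is the same through all horizontal sections. -/
theorem integral_eq_of_divergence_eq_zero {L : ℝ} (hL : 0 ≤ L) {H G : ℝ × ℝ → ℝ}
    {U : Set (ℝ × ℝ)} (hU : IsOpen U) (hUsub : Icc (0 : ℝ) L ×ˢ (univ : Set ℝ) ⊆ U)
    (hH : ContDiffOn ℝ 1 H U) (hG : ContDiffOn ℝ 1 G U)
    (hdiv : ∀ x ∈ Icc (0 : ℝ) L ×ˢ (univ : Set ℝ), pdy H x + pdz G x = 0)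
    (hH0 : ∀ z, H (0, z) = 0) (hHL : ∀ z, H (L, z) = 0) (a b : ℝ) :
    (∫ y in (0 : ℝ)..L, G (y, b)) = ∫ y in (0 : ℝ)..L, G (y, a) := by
  have hHd : ∀ x ∈ U, DifferentiableAt ℝ H x := fun x hx =>
    (hH.differentiableOn one_ne_zero).differentiableAt (hU.mem_nhds hx)
  have hGd : ∀ x ∈ U, DifferentiableAt ℝ G x := fun x hx =>
    (hG.differentiableOn one_ne_zero).differentiableAt (hU.mem_nhds hx)
  have hdiv' : ∀ x ∈ Icc (0 : ℝ) L ×ˢ (univ : Set ℝ),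
      fderiv ℝ H x (1, 0) + fderiv ℝ G x (0, 1) = 0 := fun x hx => by
    rw [← pdy_eq_fderiv (hHd x (hUsub hx)), ← pdz_eq_fderiv (hGd x (hUsub hx)), hdiv x hx]
  have hrect : uIcc 0 L ×ˢ uIcc a b ⊆ Icc (0 : ℝ) L ×ˢ (univ : Set ℝ) := by
    rw [uIcc_of_le hL]
    exact prod_mono_right (subset_univ _)
  have hinterior : ∀ x ∈ Ioo (min 0 L) (max 0 L) ×ˢ Ioo (min a b) (max a b), x ∈ U := by
    intro x hx
    rw [min_eq_left hL, max_eq_right hL] at hx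
    exact hUsub ⟨Ioo_subset_Icc_self hx.1, mem_univ _⟩
  have key := integral2_divergence_prod_of_hasFDerivAt H G (fderiv ℝ H) (fderiv ℝ G) 0 a L b
    (hH.continuousOn.mono (Subset.trans hrect hUsub)) (hG.continuousOn.mono (Subset.trans hrect hUsub))
    (fun x hx => (hHd x (hinterior x hx)).hasFDerivAt)
    (fun x hx => (hGd x (hinterior x hx)).hasFDerivAt)
    (integrableOn_zero.congr_fun (fun x hx => (hdiv' x (hrect hx)).symm)
      (measurableSet_uIcc.prod measurableSet_uIcc))
  have hzero : (∫ x in (0 : ℝ)..L, ∫ y in a..b,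
      fderiv ℝ H (x, y) (1, 0) + fderiv ℝ G (x, y) (0, 1)) = 0 := by
    refine intervalIntegral.integral_zero_ae (.of_forall fun x hx => ?_)
    refine intervalIntegral.integral_zero_ae (.of_forall fun y _ => ?_)
    rw [uIoc_of_le hL] at hx
    exact hdiv' (x, y) ⟨Ioc_subset_Icc_self hx, mem_univ _⟩
  simp only [hH0, hHL, intervalIntegral.integral_zero, hzero] at key
  linarith

/-- Uniform convergence to a constant on an interval implies convergence of the integrals. -/
theorem TendstoUniformlyOn.tendsto_integral_const {ι : Type*} {l : Filter ι} {L C : ℝ}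
    (hL : 0 ≤ L) {F : ι → ℝ → ℝ} (hF : ∀ i, IntervalIntegrable (F i) volume 0 L)
    (h : TendstoUniformlyOn F (fun _ => C) l (Icc 0 L)) :
    Tendsto (fun i => ∫ y in (0 : ℝ)..L, F i y) l (nhds (C * L)) := by
  rw [Metric.tendsto_nhds]
  intro ε hε
  have hL1 : 0 < L + 1 := by linarith
  filter_upwards [Metric.tendstoUniformlyOn_iff.1 h (ε / (L + 1)) (by positivity)] with i hi
  have hsub : (∫ y in (0 : ℝ)..L, F i y) - C * L = ∫ y in (0 : ℝ)..L, (F i y - C) := by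
    rw [intervalIntegral.integral_sub (hF i) intervalIntegrable_const]
    simp [mul_comm]
  have hbound : ‖∫ y in (0 : ℝ)..L, (F i y - C)‖ ≤ ε / (L + 1) * |L - 0| := by
    refine intervalIntegral.norm_integral_le_of_norm_le_const fun y hy => ?_
    rw [uIoc_of_le hL] at hy
    rw [Real.norm_eq_abs, ← Real.dist_eq, dist_comm]
    exact (hi y (Ioc_subset_Icc_self hy)).le
  rw [Real.dist_eq, hsub, ← Real.norm_eq_abs]
  refine hbound.trans_lt ?_
  rw [sub_zero, abs_of_nonneg hL, div_mul_eq_mul_div, div_lt_iff₀ hL1]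
  nlinarith

/-- On the doubly infinite strip, the (constant) flux
`F_c(z) = ∫₀^L [k(s)(∂_z p + g) − c s] dy` equals `(g k(s_*) − c s_*) L`,
identified from the behaviour as `z → −∞`. -/
theorem flux_value_from_minus_infinity
    (L c g sStar : ℝ) (hL : 0 < L) (hc : 0 < c) (hg : 0 < g)
    (hsStar : sStar ∈ Ioo (0:ℝ) 1)
    (k : ℝ → ℝ) (hk : ContDiff ℝ 1 k)
    (s p : ℝ × ℝ → ℝ) (U : Set (ℝ × ℝ)) (hU : IsOpen U)
    (hUsub : Icc (0:ℝ) L ×ˢ (univ : Set ℝ) ⊆ U)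
    (hs : ContDiffOn ℝ 1 s U) (hp : ContDiffOn ℝ 2 p U)
    (hRich : ∀ x ∈ Icc (0:ℝ) L ×ˢ (univ : Set ℝ),
      c * pdz s x =
        pdy (fun x' => k (s x') * pdy p x') x
          + pdz (fun x' => k (s x') * (pdz p x' + g)) x)
    (hNeu : ∀ z : ℝ, pdy p (0, z) = 0 ∧ pdy p (L, z) = 0)
    (hbot_s : TendstoUniformlyOn (fun z y => s (y, z)) (fun _ => sStar)
      atBot (Icc (0:ℝ) L))
    (hbot_p : TendstoUniformlyOn
      (fun z y => (k (s (y, z)) * pdy p (y, z), k (s (y, z)) * pdz p (y, z)))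
      (fun _ => ((0:ℝ), (0:ℝ))) atBot (Icc (0:ℝ) L)) :
    ∀ z : ℝ,
      (∫ y in (0:ℝ)..L, (k (s (y, z)) * (pdz p (y, z) + g) - c * s (y, z)))
        = (g * k sStar - c * sStar) * L := by
  have hks : ContDiffOn ℝ 1 (fun x => k (s x)) U := hk.comp_contDiffOn hs
  have hH : ContDiffOn ℝ 1 (fun x => k (s x) * pdy p x) U := hks.mul (hp.pdy hU)
  have hV : ContDiffOn ℝ 1 (fun x => k (s x) * (pdz p x + g)) U :=
    hks.mul ((hp.pdz hU).add contDiffOn_const)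
  have hG : ContDiffOn ℝ 1 (fun x => k (s x) * (pdz p x + g) - c * s x) U :=
    hV.sub (contDiffOn_const.mul hs)
  have hdiv : ∀ x ∈ Icc (0 : ℝ) L ×ˢ (univ : Set ℝ),
      pdy (fun x' => k (s x') * pdy p x') x
        + pdz (fun x' => k (s x') * (pdz p x' + g) - c * s x') x = 0 := by
    intro x hx
    have hxU := hU.mem_nhds (hUsub hx)
    have hVx := (hV.differentiableOn one_ne_zero).differentiableAt hxU
    have hsx := (hs.differentiableOn one_ne_zero).differentiableAt hxU
    have hsub : pdz (fun x' => k (s x') * (pdz p x' + g) - c * s x') x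
        = pdz (fun x' => k (s x') * (pdz p x' + g)) x - c * pdz s x := by
      rw [pdz_eq_fderiv hVx, pdz_eq_fderiv hsx, pdz_eq_fderiv (hVx.fun_sub (hsx.const_mul c)),
        fderiv_fun_sub hVx (hsx.const_mul c), fderiv_const_mul hsx c]
      simp
    rw [hsub, hRich x hx]
    ring
  have hconst := integral_eq_of_divergence_eq_zero hL.le hU hUsub hH hG hdiv
    (fun z => by simp [(hNeu z).1]) (fun z => by simp [(hNeu z).2])
  have hint : ∀ z, IntervalIntegrable
      (fun y => k (s (y, z)) * (pdz p (y, z) + g) - c * s (y, z)) volume 0 L := by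
    intro z
    refine ContinuousOn.intervalIntegrable_of_Icc hL.le ?_
    exact hG.continuousOn.comp (f := fun y => (y, z)) (by fun_prop)
      fun y hy => hUsub ⟨hy, mem_univ _⟩
  have hunif : TendstoUniformlyOn
      (fun z y => k (s (y, z)) * (pdz p (y, z) + g) - c * s (y, z))
      (fun _ => g * k sStar - c * sStar) atBot (Icc 0 L) := by
    rw [← tendsto_prod_principal_iff] at hbot_s hbot_p ⊢
    have hkp := (continuous_snd.tendsto ((0 : ℝ), (0 : ℝ))).comp hbot_p
    have hkk := (hk.continuous.tendsto sStar).comp hbot_s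
    convert (hkp.add (hkk.const_mul g)).sub (hbot_s.const_mul c) using 1
    · ext ⟨z, y⟩
      simp only [Function.HasUncurry.uncurry, Function.comp_apply, id]
      ring
    · simp
  intro z
  refine tendsto_nhds_unique ?_ (hunif.tendsto_integral_const hL.le hint)
  exact tendsto_const_nhds.congr fun a => hconst a z
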